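/- Let N ≥ 2 be an integer. For every δ ∈ (0, π/2) there exist a bounded open set Ω ⊂ ℝ^N with Ω ⊆ C_{π/2+δ} and 0 ∈ ∂Ω, and a function u ∈ C_c^∞(Ω) with ∫_Ω u(x)²/|x|² dx > 0, such that ∫_Ω |∇u(x)|² dx < (N²/4) ∫_Ω u(x)²/|x|² dx. In particular the best Hardy constant μ(Ω) = inf{∫_Ω |∇u|² dx / ∫_Ω u²/|x|² dx : u ∈ C_c^∞(Ω), ∫_Ω u²/|x|² dx > 0} satisfies μ(Ω) < N²/4. -/

import Mathlib

open Real MeasureTheory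

/-- The last coordinate `x_N` of a point `x ∈ ℝ^N`. -/
noncomputable def lastCoord {N : ℕ} (x : EuclideanSpace ℝ (Fin N)) : ℝ :=
  ∑ i : Fin N, if (i : ℕ) + 1 = N then x i else 0

/-- The open cone of aperture `γ`: `C_γ = {x : |x| > 0 ∧ x_N > |x| cos γ}`. -/
def cone (N : ℕ) (γ : ℝ) : Set (EuclideanSpace ℝ (Fin N)) :=
  {x | 0 < ‖x‖ ∧ ‖x‖ * Real.cos γ < lastCoord x}

/-- The best Hardy constant of an open set `Ω` with the singularity at the origin. -/
noncomputable def hardyConst {N : ℕ} (Ω : Set (EuclideanSpace ℝ (Fin N))) : ℝ :=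
  sInf {ρ : ℝ | ∃ u : EuclideanSpace ℝ (Fin N) → ℝ,
    ContDiff ℝ (⊤ : ℕ∞) u ∧ HasCompactSupport u ∧ tsupport u ⊆ Ω ∧
    0 < (∫ x in Ω, (u x) ^ 2 / ‖x‖ ^ 2) ∧
    ρ = (∫ x in Ω, ‖gradient u x‖ ^ 2) / ∫ x in Ω, (u x) ^ 2 / ‖x‖ ^ 2}


namespace HardyAux

open Filter Topology

abbrev EE (N : ℕ) := EuclideanSpace ℝ (Fin N)

noncomputable def ee {N : ℕ} (i : Fin N) : EE N := EuclideanSpace.single i (1:ℝ)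

lemma normsq_gradient {N : ℕ} (u : EE N → ℝ) (x : EE N) :
    ‖gradient u x‖ ^ 2 = ∑ i, (fderiv ℝ u x (ee i)) ^ 2 := by
  rw [EuclideanSpace.real_norm_sq_eq]
  refine Finset.sum_congr rfl fun i _ => ?_
  congr 1
  have h : inner ℝ (gradient u x) (ee i) = fderiv ℝ u x (ee i) := by
    simp [gradient]
  rw [← h, ee, EuclideanSpace.inner_single_right]
  simp

lemma green {N : ℕ} (u : EE N → ℝ) (hu : ContDiff ℝ (⊤ : ℕ∞) u) (hc : HasCompactSupport u) :
    Integrable (fun x => ‖gradient u x‖ ^ 2) ∧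
    Integrable (fun x => u x * ∑ i, fderiv ℝ (fun y => fderiv ℝ u y (ee i)) x (ee i)) ∧
    ∫ x, ‖gradient u x‖ ^ 2 =
      ∫ x, -(u x * ∑ i, fderiv ℝ (fun y => fderiv ℝ u y (ee i)) x (ee i)) := by
  have h1 : ∀ i : Fin N, ContDiff ℝ (⊤ : ℕ∞) (fun y => fderiv ℝ u y (ee i)) := fun i =>
    (hu.fderiv_right (m := (⊤ : ℕ∞)) (by simp)).clm_apply contDiff_const
  have hs1 : ∀ i : Fin N, HasCompactSupport (fun y => fderiv ℝ u y (ee i)) := fun i =>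
    hc.fderiv_apply ℝ (ee i)
  have h2 : ∀ i : Fin N, Continuous
      (fun x => fderiv ℝ (fun y => fderiv ℝ u y (ee i)) x (ee i)) := fun i =>
    (((h1 i).fderiv_right (m := (⊤ : ℕ∞)) (by simp)).clm_apply contDiff_const).continuous
  have hI1 : ∀ i : Fin N, Integrable (fun x => fderiv ℝ u x (ee i) * fderiv ℝ u x (ee i)) :=
    fun i => ((h1 i).continuous.mul (h1 i).continuous).integrable_of_hasCompactSupport
      ((hs1 i).mul_right)
  have hI2 : ∀ i : Fin N, Integrable
      (fun x => u x * fderiv ℝ (fun y => fderiv ℝ u y (ee i)) x (ee i)) :=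
    fun i => (hu.continuous.mul (h2 i)).integrable_of_hasCompactSupport hc.mul_right
  have hI3 : ∀ i : Fin N, Integrable (fun x => u x * fderiv ℝ u x (ee i)) :=
    fun i => (hu.continuous.mul (h1 i).continuous).integrable_of_hasCompactSupport hc.mul_right
  have hsum : (fun x => u x * ∑ i, fderiv ℝ (fun y => fderiv ℝ u y (ee i)) x (ee i)) =
      fun x => ∑ i, u x * fderiv ℝ (fun y => fderiv ℝ u y (ee i)) x (ee i) := by
    funext x; rw [Finset.mul_sum]
  have hgr : (fun x => ‖gradient u x‖ ^ 2) =
      fun x => ∑ i, fderiv ℝ u x (ee i) * fderiv ℝ u x (ee i) := by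
    funext x; rw [normsq_gradient]; simp only [sq]
  refine ⟨?_, ?_, ?_⟩
  · rw [hgr]; exact integrable_finsetSum _ fun i _ => hI1 i
  · rw [hsum]; exact integrable_finsetSum _ fun i _ => hI2 i
  · rw [integral_neg, hsum, hgr, integral_finsetSum _ fun i _ => hI1 i,
      integral_finsetSum _ fun i _ => hI2 i, ← Finset.sum_neg_distrib]
    refine Finset.sum_congr rfl fun i _ => ?_
    rw [integral_mul_fderiv_eq_neg_fderiv_mul_of_integrable (hI1 i) (hI2 i) (hI3 i)
      (fun x _ => hu.differentiable (by simp) x) (fun x _ => (h1 i).differentiable (by simp) x)]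
    simp

/-- the convex cut-off -/
noncomputable def GG (t : ℝ) : ℝ := t * expNegInvGlue t
noncomputable def G1 (t : ℝ) : ℝ := expNegInvGlue t * (1 + 1 / t)
noncomputable def G2 (t : ℝ) : ℝ := expNegInvGlue t / t ^ 3

lemma hasDeriv_E {t : ℝ} (ht : 0 < t) : HasDerivAt expNegInvGlue (expNegInvGlue t / t ^ 2) t := by
  have h1 : HasDerivAt (fun s : ℝ => Real.exp (-s⁻¹)) (Real.exp (-t⁻¹) * (-(-(t ^ 2)⁻¹))) t :=
    ((hasDerivAt_inv ht.ne').neg).exp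
  have h2 : expNegInvGlue =ᶠ[𝓝 t] fun s : ℝ => Real.exp (-s⁻¹) := by
    filter_upwards [lt_mem_nhds ht] with s hs
    simp [expNegInvGlue, not_le.2 hs]
  refine (h1.congr_of_eventuallyEq h2).congr_deriv ?_
  simp [expNegInvGlue, not_le.2 ht, div_eq_mul_inv]

lemma hasDeriv_G {t : ℝ} (ht : 0 < t) : HasDerivAt GG (G1 t) t := by
  refine ((hasDerivAt_id t).mul (hasDeriv_E ht)).congr_deriv ?_
  simp only [G1, id]; field_simp

lemma hasDeriv_G1 {t : ℝ} (ht : 0 < t) : HasDerivAt G1 (G2 t) t := by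
  have := (hasDeriv_E ht).mul (((hasDerivAt_inv ht.ne')).const_add 1)
  have h2 : G1 = (expNegInvGlue * fun s : ℝ => 1 + s⁻¹) := by
    funext s; simp [G1]
  rw [h2]
  refine this.congr_deriv ?_
  simp only [G2]; field_simp; ring

lemma E_le_one (t : ℝ) : expNegInvGlue t ≤ 1 := by
  unfold expNegInvGlue
  split_ifs with h
  · norm_num
  · push Not at h
    rw [Real.exp_le_one_iff]; have := inv_pos.2 h; linarith

lemma GG_nonneg (t : ℝ) : 0 ≤ GG t := by
  rcases le_total t 0 with h | h
  · simp [GG, expNegInvGlue.zero_of_nonpos h]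
  · exact mul_nonneg h (expNegInvGlue.nonneg t)

lemma GG_zero {t : ℝ} (h : t ≤ 0) : GG t = 0 := by simp [GG, expNegInvGlue.zero_of_nonpos h]

lemma GG_lower {t : ℝ} (h : 1 ≤ t) : t * Real.exp (-1) ≤ GG t := by
  have ht : 0 < t := by linarith
  unfold GG
  refine mul_le_mul_of_nonneg_left ?_ ht.le
  simp only [expNegInvGlue, not_le.2 ht, if_false]
  rw [Real.exp_le_exp]
  have := inv_le_one_of_one_le₀ h; linarith

lemma GG_smooth : ContDiff ℝ (⊤ : ℕ∞) GG :=
  contDiff_id.mul expNegInvGlue.contDiff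

/-- pointwise algebra -/
lemma pointwise_alg {t q c d S L : ℝ} (ht : 0 < t) (hq : 1 ≤ q) (hc : 0 ≤ c) (hd : 0 < d)
    (hS : 0 ≤ S) (hL : -(c * (t + 1)) ≤ q * L) :
    -(GG t * (G2 t * S + G1 t * L)) ≤ (c + d / 2) * (GG t ^ 2 / q) + (2 * c ^ 2 / d + c) := by
  have hE := expNegInvGlue.nonneg t
  have hE1 := E_le_one t
  have hG := GG_nonneg t
  have hq0 : 0 < q := by linarith
  have hG2 : 0 ≤ G2 t := by unfold G2; positivity
  have hG1 : 0 ≤ G1 t := by unfold G1; positivity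
  have h1 : -(GG t * (G2 t * S + G1 t * L)) ≤ GG t * G1 t * (c * (t + 1) / q) := by
    have hL' : -L ≤ c * (t + 1) / q := by
      rw [le_div_iff₀ hq0]; linarith
    have := mul_le_mul_of_nonneg_left hL' (mul_nonneg hG hG1)
    have := mul_nonneg hG (mul_nonneg hG2 hS)
    nlinarith
  have h2 : GG t * G1 t * (t + 1) = GG t ^ 2 + 2 * expNegInvGlue t * GG t + expNegInvGlue t ^ 2 := by
    simp only [GG, G1]; field_simp; ring
  have h3 : GG t * G1 t * (c * (t + 1) / q) =
      c * (GG t ^ 2 + 2 * expNegInvGlue t * GG t + expNegInvGlue t ^ 2) / q := by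
    rw [← h2]; ring
  rw [h3] at h1
  refine h1.trans ?_
  have h4 : c * (GG t ^ 2 + 2 * expNegInvGlue t * GG t + expNegInvGlue t ^ 2) ≤
      (c + d / 2) * GG t ^ 2 + (2 * c ^ 2 / d + c) := by
    have e1 : expNegInvGlue t * GG t ≤ GG t := mul_le_of_le_one_left hG hE1
    have e2 : expNegInvGlue t ^ 2 ≤ 1 := pow_le_one₀ hE hE1
    have e3 : c * (2 * GG t) ≤ d / 2 * GG t ^ 2 + 2 * c ^ 2 / d := by
      have : d / 2 * GG t ^ 2 + 2 * c ^ 2 / d - c * (2 * GG t) = (d * GG t - 2 * c) ^ 2 / (2 * d) := by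
        field_simp; ring
      have : 0 ≤ (d * GG t - 2 * c) ^ 2 / (2 * d) := by positivity
      linarith
    nlinarith
  have hC : 0 ≤ 2 * c ^ 2 / d + c := by positivity
  calc _ ≤ ((c + d / 2) * GG t ^ 2 + (2 * c ^ 2 / d + c)) / q := by gcongr
    _ = (c + d / 2) * (GG t ^ 2 / q) + (2 * c ^ 2 / d + c) / q := by ring
    _ ≤ _ := by gcongr; exact div_le_self hC hq

section phi
variable {N : ℕ}

lemma line_coord (x : EE N) (i l : Fin N) :
    HasDerivAt (fun s : ℝ => (x + s • ee i) l) (if l = i then 1 else 0) 0 := by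
  have : (fun s : ℝ => (x + s • ee i) l) = fun s => x l + s * (if l = i then 1 else 0) := by
    funext s
    simp [ee]
  rw [this]
  simpa using ((hasDerivAt_id (0:ℝ)).mul_const (if l = i then (1:ℝ) else 0)).const_add (x l)

lemma line_q (x : EE N) (i : Fin N) :
    HasDerivAt (fun s : ℝ => ‖x + s • ee i‖ ^ 2) (2 * x i) 0 := by
  have : (fun s : ℝ => ‖x + s • ee i‖ ^ 2) = fun s => ‖x‖ ^ 2 + 2 * (s * x i) + s ^ 2 := by
    funext s
    rw [norm_add_sq_real]
    simp [ee, inner_smul_right, EuclideanSpace.inner_single_right, norm_smul]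
  rw [this]
  have h := ((((hasDerivAt_id (0:ℝ)).mul_const (x i)).const_mul 2).const_add (‖x‖^2)).add
    (hasDerivAt_pow 2 (0:ℝ))
  exact h.congr_deriv (by simp)

lemma line_log (x : EE N) (hx : x ≠ 0) (i : Fin N) :
    HasDerivAt (fun s : ℝ => Real.log (‖x + s • ee i‖ ^ 2)) (2 * x i / ‖x‖ ^ 2) 0 := by
  have h := (line_q x i).log (by simpa using hx)
  simpa using h

lemma line_comp (x : EE N) (hx : x ≠ 0) (i : Fin N) {α : ℝ → ℝ} {a' : ℝ}
    (h : HasDerivAt α a' (Real.log (‖x‖ ^ 2))) :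
    HasDerivAt (fun s : ℝ => α (Real.log (‖x + s • ee i‖ ^ 2))) (a' * (2 * x i / ‖x‖ ^ 2)) 0 := by
  have h' : HasDerivAt α a' (Real.log (‖x + (0:ℝ) • ee i‖ ^ 2)) := by simpa using h
  exact HasDerivAt.comp (0:ℝ) h' (line_log x hx i)

noncomputable def D1 (j : Fin N) (α α1 β1 : ℝ → ℝ) (i : Fin N) (x : EE N) : ℝ :=
  (if j = i then 1 else 0) * α (Real.log (‖x‖ ^ 2)) +
    (x j * α1 (Real.log (‖x‖ ^ 2)) + β1 (Real.log (‖x‖ ^ 2))) * (2 * x i / ‖x‖ ^ 2)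

noncomputable def D2 (j : Fin N) (α1 β1 α2 β2 : ℝ → ℝ) (i : Fin N) (x : EE N) : ℝ :=
  2 * (if j = i then 1 else 0) * α1 (Real.log (‖x‖ ^ 2)) * (2 * x i / ‖x‖ ^ 2) +
    (x j * α2 (Real.log (‖x‖ ^ 2)) + β2 (Real.log (‖x‖ ^ 2))) * (2 * x i / ‖x‖ ^ 2) ^ 2 +
    (x j * α1 (Real.log (‖x‖ ^ 2)) + β1 (Real.log (‖x‖ ^ 2))) *
      (2 / ‖x‖ ^ 2 - (2 * x i) ^ 2 / ‖x‖ ^ 4)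

noncomputable def Phi (j : Fin N) (α β : ℝ → ℝ) (x : EE N) : ℝ :=
  x j * α (Real.log (‖x‖ ^ 2)) + β (Real.log (‖x‖ ^ 2))

lemma hasD1 (j : Fin N) {α β α1 β1 : ℝ → ℝ} (hα : ∀ t, HasDerivAt α (α1 t) t)
    (hβ : ∀ t, HasDerivAt β (β1 t) t) (i : Fin N) (x : EE N) (hx : x ≠ 0) :
    HasDerivAt (fun s : ℝ => Phi j α β (x + s • ee i)) (D1 j α α1 β1 i x) 0 := by
  have h := ((line_coord x i j).mul (line_comp x hx i (hα _))).add (line_comp x hx i (hβ _))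
  unfold Phi
  refine h.congr_deriv ?_
  simp [D1]; ring

lemma hasD2 (j : Fin N) {α α1 α2 β1 β2 : ℝ → ℝ} (hα : ∀ t, HasDerivAt α (α1 t) t)
    (hα1 : ∀ t, HasDerivAt α1 (α2 t) t)
    (hβ : ∀ t, HasDerivAt β1 (β2 t) t) (i : Fin N) (x : EE N) (hx : x ≠ 0) :
    HasDerivAt (fun s : ℝ => D1 j α α1 β1 i (x + s • ee i)) (D2 j α1 β1 α2 β2 i x) 0 := by
  have hq : ‖x‖ ≠ 0 := by simpa using hx
  have h := ((line_comp x hx i (hα _)).const_mul (if j = i then (1:ℝ) else 0)).add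
    ((((line_coord x i j).mul (line_comp x hx i (hα1 _))).add (line_comp x hx i (hβ _))).mul
      (((line_coord x i i).const_mul 2).div (line_q x i) (by simpa using hx)))
  unfold D1
  refine h.congr_deriv ?_
  simp only [D2]
  split_ifs with hji
  · subst hji; simp; field_simp; try ring
  · simp; field_simp; try ring

lemma sum_D2 (j : Fin N) (α1 β1 α2 β2 : ℝ → ℝ) (x : EE N) (hx : x ≠ 0) :
    ‖x‖ ^ 2 * ∑ i, D2 j α1 β1 α2 β2 i x =
      x j * (4 * α2 (Real.log (‖x‖ ^ 2)) + 2 * N * α1 (Real.log (‖x‖ ^ 2))) +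
        (4 * β2 (Real.log (‖x‖ ^ 2)) + (2 * N - 4) * β1 (Real.log (‖x‖ ^ 2))) := by
  have hq : ‖x‖ ≠ 0 := by simpa using hx
  unfold D2
  generalize Real.log (‖x‖ ^ 2) = t
  have hs := EuclideanSpace.real_norm_sq_eq x
  have e : ∀ i, 2 * (if j = i then 1 else 0) * α1 t * (2 * x i / ‖x‖ ^ 2) +
    (x j * α2 t + β2 t) * (2 * x i / ‖x‖ ^ 2) ^ 2 +
    (x j * α1 t + β1 t) * (2 / ‖x‖ ^ 2 - (2 * x i) ^ 2 / ‖x‖ ^ 4) =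
    (if j = i then 4 * α1 t / ‖x‖ ^ 2 * x i else 0) +
    (4 * (x j * α2 t + β2 t) / ‖x‖ ^ 4 - 4 * (x j * α1 t + β1 t) / ‖x‖ ^ 4) * x i ^ 2 +
    (x j * α1 t + β1 t) * (2 / ‖x‖ ^ 2) := by
    intro i
    split_ifs <;> ring
  rw [Finset.sum_congr rfl fun i _ => e i, Finset.sum_add_distrib, Finset.sum_add_distrib,
    ← Finset.mul_sum, ← hs]
  simp
  field_simp
  ring

end phi

section osc

noncomputable def osc (b p t : ℝ) : ℝ := Real.exp (p * t) * Real.sin (b * t)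
noncomputable def osc1 (b p t : ℝ) : ℝ :=
  Real.exp (p * t) * (p * Real.sin (b * t) + b * Real.cos (b * t))
noncomputable def osc2 (b p t : ℝ) : ℝ :=
  Real.exp (p * t) * ((p ^ 2 - b ^ 2) * Real.sin (b * t) + 2 * p * b * Real.cos (b * t))

lemma has_osc (b p t : ℝ) : HasDerivAt (osc b p) (osc1 b p t) t := by
  have h1 := ((hasDerivAt_id t).const_mul p).exp
  have h2 := ((hasDerivAt_id t).const_mul b).sin
  refine (h1.mul h2).congr_deriv ?_
  simp [osc1]; ring

lemma has_osc1 (b p t : ℝ) : HasDerivAt (osc1 b p) (osc2 b p t) t := by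
  have h1 := ((hasDerivAt_id t).const_mul p).exp
  have h2 := ((hasDerivAt_id t).const_mul b).sin
  have h3 := ((hasDerivAt_id t).const_mul b).cos
  refine (h1.mul ((h2.const_mul p).add (h3.const_mul b))).congr_deriv ?_
  simp [osc2]; ring

lemma osc_smooth (b p : ℝ) : ContDiff ℝ (⊤ : ℕ∞) (osc b p) := by
  unfold osc
  fun_prop

end osc

section main
variable {N : ℕ}

/-- the test profile -/
noncomputable def PP (j : Fin N) (b ε : ℝ) : EE N → ℝ :=
  Phi j (osc b (-(N / 4))) (fun t => ε * osc b (1 / 2 - N / 4) t)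

def UU (j : Fin N) (b ε : ℝ) : Set (EE N) :=
  {x | 1 < ‖x‖ ∧ ‖x‖ < Real.exp (π / (2 * b)) ∧ 0 < x j + ε * ‖x‖}

lemma exp_half_log (x : EE N) (hx : x ≠ 0) : Real.exp (1 / 2 * Real.log (‖x‖ ^ 2)) = ‖x‖ := by
  have : 0 < ‖x‖ := by simpa using hx
  rw [Real.log_pow]
  push_cast
  rw [show 1 / 2 * (2 * Real.log ‖x‖) = Real.log ‖x‖ by ring, Real.exp_log this]

lemma PP_eq (j : Fin N) (b ε : ℝ) (x : EE N) (hx : x ≠ 0) :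
    PP j b ε x = (x j + ε * ‖x‖) * osc b (-(N / 4)) (Real.log (‖x‖ ^ 2)) := by
  have h := exp_half_log x hx
  simp only [PP, Phi, osc]
  rw [sub_mul, sub_eq_add_neg, Real.exp_add, h, ← neg_mul]
  ring

lemma PP_smooth (j : Fin N) (b ε : ℝ) (x : EE N) (hx : x ≠ 0) :
    ContDiffAt ℝ (⊤ : ℕ∞) (PP j b ε) x := by
  have h1 : ContDiffAt ℝ (⊤ : ℕ∞) (fun x : EE N => Real.log (‖x‖ ^ 2)) x :=
    (contDiff_norm_sq ℝ).contDiffAt.log (by simpa using hx)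
  have h2 : ContDiffAt ℝ (⊤ : ℕ∞) (fun x : EE N => x j) x := by fun_prop
  unfold PP Phi
  exact (h2.mul ((osc_smooth _ _).contDiffAt.comp x h1)).add
    (contDiffAt_const.mul ((osc_smooth _ _).contDiffAt.comp x h1))

lemma UU_open (j : Fin N) (b ε : ℝ) : IsOpen (UU j b ε) := by
  unfold UU
  refine (isOpen_lt continuous_const continuous_norm).inter
    ((isOpen_lt continuous_norm continuous_const).inter
      (?_ : IsOpen {x : EE N | 0 < x j + ε * ‖x‖}))
  exact isOpen_lt continuous_const (by fun_prop)

lemma UU_ne (j : Fin N) (b ε : ℝ) {x : EE N} (hx : x ∈ UU j b ε) : x ≠ 0 := by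
  have := hx.1
  rintro rfl
  simp at this; linarith

lemma UU_osc_pos {j : Fin N} {b ε : ℝ} (hb : 0 < b) (p : ℝ) {x : EE N} (hx : x ∈ UU j b ε) :
    0 < osc b p (Real.log (‖x‖ ^ 2)) := by
  obtain ⟨h1, h2, -⟩ := hx
  have h3 : 0 < Real.log ‖x‖ := Real.log_pos h1
  have h4 : Real.log ‖x‖ < π / (2 * b) := by
    rw [Real.log_lt_iff_lt_exp (by linarith)]; exact h2
  rw [lt_div_iff₀ (by positivity)] at h4
  refine mul_pos (Real.exp_pos _) (Real.sin_pos_of_pos_of_lt_pi ?_ ?_)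
  · rw [Real.log_pow]; push_cast; positivity
  · rw [Real.log_pow]; push_cast; linarith

lemma boundary {j : Fin N} {b ε : ℝ} (hb : 0 < b) (k : ℝ) (x : EE N) (hx : x ∉ UU j b ε) :
    ∀ᶠ y in 𝓝 x, y ∉ UU j b ε ∨ k * PP j b ε y - 1 < 0 := by
  by_cases h1 : ‖x‖ < 1
  · have : ∀ᶠ y : EE N in 𝓝 x, ‖y‖ < 1 := continuous_norm.continuousAt.eventually_lt_const h1
    filter_upwards [this] with y hy
    left; intro h; linarith [h.1]
  by_cases h2 : Real.exp (π / (2 * b)) < ‖x‖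
  · have : ∀ᶠ y : EE N in 𝓝 x, Real.exp (π / (2 * b)) < ‖y‖ :=
      continuous_norm.continuousAt.eventually_const_lt h2
    filter_upwards [this] with y hy
    left; intro h; linarith [h.2.1]
  by_cases h3 : x j + ε * ‖x‖ < 0
  · have hcont : Continuous (fun y : EE N => y j + ε * ‖y‖) := by fun_prop
    have : ∀ᶠ y : EE N in 𝓝 x, y j + ε * ‖y‖ < 0 := hcont.continuousAt.eventually_lt_const h3
    filter_upwards [this] with y hy
    left; intro h; linarith [h.2.2]
  push Not at h1 h2 h3
  have hx0 : x ≠ 0 := by rintro rfl; simp at h1; linarith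
  have hP : PP j b ε x = 0 := by
    rw [PP_eq j b ε x hx0]
    by_cases e1 : ‖x‖ = 1
    · simp [e1, osc]
    by_cases e2 : ‖x‖ = Real.exp (π / (2 * b))
    · have : b * Real.log (‖x‖ ^ 2) = π := by
        rw [e2, Real.log_pow, Real.log_exp]; push_cast; field_simp
      simp only [osc]; rw [this]; simp
    by_cases e3 : x j + ε * ‖x‖ = 0
    · rw [e3]; simp
    exact absurd ⟨lt_of_le_of_ne h1 (Ne.symm e1), lt_of_le_of_ne h2 e2,
      lt_of_le_of_ne h3 (Ne.symm e3)⟩ hx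
  have hc : ContinuousAt (fun y => k * PP j b ε y - 1) x :=
    (continuousAt_const.mul (PP_smooth j b ε x hx0).continuousAt).sub continuousAt_const
  have := hc.eventually_lt_const (u := 0) (by simp [hP])
  filter_upwards [this] with y hy
  exact Or.inr hy

open Classical in
noncomputable def uu (j : Fin N) (b ε k : ℝ) (x : EE N) : ℝ :=
  if x ∈ UU j b ε then GG (k * PP j b ε x - 1) else 0

lemma uu_zero_near {j : Fin N} {b ε : ℝ} (hb : 0 < b) (k : ℝ) (x : EE N) (hx : x ∉ UU j b ε) :
    uu j b ε k =ᶠ[𝓝 x] fun _ => 0 := by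
  filter_upwards [boundary hb k x hx] with y hy
  unfold uu
  split_ifs with h
  · rcases hy with hy | hy
    · exact absurd h hy
    · exact GG_zero hy.le
  · rfl

lemma uu_near {j : Fin N} {b ε : ℝ} (k : ℝ) (x : EE N) (hx : x ∈ UU j b ε) :
    uu j b ε k =ᶠ[𝓝 x] fun y => GG (k * PP j b ε y - 1) := by
  filter_upwards [(UU_open j b ε).mem_nhds hx] with y hy
  simp [uu, hy]

lemma uu_smooth {j : Fin N} {b ε : ℝ} (hb : 0 < b) (k : ℝ) :
    ContDiff ℝ (⊤ : ℕ∞) (uu j b ε k) := by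
  rw [contDiff_iff_contDiffAt]
  intro x
  by_cases hx : x ∈ UU j b ε
  · refine ContDiffAt.congr_of_eventuallyEq ?_ (uu_near k x hx)
    exact GG_smooth.contDiffAt.comp x
      ((contDiffAt_const.mul (PP_smooth j b ε x (UU_ne j b ε hx))).sub contDiffAt_const)
  · exact contDiffAt_const.congr_of_eventuallyEq (uu_zero_near hb k x hx)

lemma uu_tsupport {j : Fin N} {b ε : ℝ} (hb : 0 < b) (k : ℝ) :
    tsupport (uu j b ε k) ⊆ UU j b ε := by
  intro x hx
  by_contra h
  rw [← notMem_tsupport_iff_eventuallyEq.symm.not_left] at hx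
  exact hx (uu_zero_near hb k x h)

lemma UU_sub (j : Fin N) (b ε : ℝ) :
    UU j b ε ⊆ Metric.closedBall 0 (Real.exp (π / (2 * b))) := by
  intro x hx
  simpa using hx.2.1.le

lemma uu_compact {j : Fin N} {b ε : ℝ} (hb : 0 < b) (k : ℝ) :
    HasCompactSupport (uu j b ε k) :=
  (isCompact_closedBall (0 : EE N) (Real.exp (π / (2 * b)))).of_isClosed_subset
    (isClosed_tsupport _) ((uu_tsupport hb k).trans (UU_sub j b ε))

lemma line_fderiv {u : EE N → ℝ} {x v : EE N} {d : ℝ} (hu : DifferentiableAt ℝ u x)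
    (h : HasDerivAt (fun s : ℝ => u (x + s • v)) d 0) : fderiv ℝ u x v = d := by
  rw [← hu.lineDeriv_eq_fderiv]
  exact HasLineDerivAt.lineDeriv h

lemma line_tendsto (x v : EE N) : Tendsto (fun s : ℝ => x + s • v) (𝓝 0) (𝓝 x) := by
  have : Continuous (fun s : ℝ => x + s • v) := by fun_prop
  simpa using this.tendsto 0

lemma qLap {j : Fin N} {b ε : ℝ} (x : EE N) (hx : x ≠ 0) :
    ‖x‖ ^ 2 * ∑ i, D2 j (osc1 b (-(N / 4))) (fun t => ε * osc1 b (1 / 2 - N / 4) t)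
      (osc2 b (-(N / 4))) (fun t => ε * osc2 b (1 / 2 - N / 4) t) i x =
    -((N : ℝ) ^ 2 / 4 + 4 * b ^ 2) * PP j b ε x +
      ε * (N - 1) * ‖x‖ * osc b (-(N / 4)) (Real.log (‖x‖ ^ 2)) := by
  rw [sum_D2 _ _ _ _ _ x hx, PP_eq j b ε x hx]
  have h := exp_half_log x hx
  have h' : Real.exp ((1 / 2 - N / 4) * Real.log (‖x‖ ^ 2)) =
      ‖x‖ * Real.exp (-(N / 4) * Real.log (‖x‖ ^ 2)) := by
    rw [sub_mul, sub_eq_add_neg, Real.exp_add, h, ← neg_mul]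
  simp only [osc, osc1, osc2, h']
  ring

lemma uu_lap {j : Fin N} {b ε : ℝ} (hb : 0 < b) (k : ℝ) (x : EE N) (hx : x ∈ UU j b ε)
    (ht : 0 < k * PP j b ε x - 1) (i : Fin N) :
    fderiv ℝ (fun y => fderiv ℝ (uu j b ε k) y (ee i)) x (ee i) =
      G2 (k * PP j b ε x - 1) * (k * D1 j (osc b (-(N / 4))) (osc1 b (-(N / 4)))
        (fun t => ε * osc1 b (1 / 2 - N / 4) t) i x) ^ 2 +
      G1 (k * PP j b ε x - 1) * (k * D2 j (osc1 b (-(N / 4)))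
        (fun t => ε * osc1 b (1 / 2 - N / 4) t)
      (osc2 b (-(N / 4))) (fun t => ε * osc2 b (1 / 2 - N / 4) t) i x) := by
  have hsm := uu_smooth (j := j) (ε := ε) hb k
  have hd : ContDiff ℝ (⊤ : ℕ∞) (fun y => fderiv ℝ (uu j b ε k) y (ee i)) :=
    (hsm.fderiv_right (m := (⊤ : ℕ∞)) (by simp)).clm_apply contDiff_const
  set d1 := D1 j (osc b (-(N / 4))) (osc1 b (-(N / 4)))
        (fun t => ε * osc1 b (1 / 2 - N / 4) t) i with hd1
  have hPP : ∀ y : EE N, y ≠ 0 →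
      HasDerivAt (fun s : ℝ => k * PP j b ε (y + s • ee i) - 1) (k * d1 y) 0 := fun y hy =>
    ((hasD1 j (fun t => has_osc b _ t) (fun t => (has_osc b _ t).const_mul ε) i y hy).const_mul
      k).sub_const 1
  have first : ∀ y ∈ UU j b ε, 0 < k * PP j b ε y - 1 →
      fderiv ℝ (uu j b ε k) y (ee i) = G1 (k * PP j b ε y - 1) * (k * d1 y) := by
    intro y hy hty
    refine line_fderiv (hsm.differentiable (by simp) y) ?_
    have e : (fun s : ℝ => uu j b ε k (y + s • ee i)) =ᶠ[𝓝 0]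
        fun s => GG (k * PP j b ε (y + s • ee i) - 1) :=
      (line_tendsto y (ee i)).eventually (uu_near k y hy)
    refine HasDerivAt.congr_of_eventuallyEq ?_ e
    have hG : HasDerivAt GG (G1 (k * PP j b ε y - 1)) (k * PP j b ε (y + (0:ℝ) • ee i) - 1) := by
      simpa using hasDeriv_G hty
    exact HasDerivAt.comp (0:ℝ) hG (hPP y (UU_ne j b ε hy))
  have hx0 := UU_ne j b ε hx
  refine line_fderiv (hd.differentiable (by simp) x) ?_
  have hc : ContinuousAt (fun y => k * PP j b ε y - 1) x :=
    (continuousAt_const.mul (PP_smooth j b ε x hx0).continuousAt).sub continuousAt_const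
  have e0 : ∀ᶠ y in 𝓝 x, fderiv ℝ (uu j b ε k) y (ee i) =
      G1 (k * PP j b ε y - 1) * (k * d1 y) := by
    filter_upwards [(UU_open j b ε).mem_nhds hx, hc.eventually_const_lt ht] with y h1 h2
    exact first y h1 h2
  have e : (fun s : ℝ => fderiv ℝ (uu j b ε k) (x + s • ee i) (ee i)) =ᶠ[𝓝 0]
      fun s => G1 (k * PP j b ε (x + s • ee i) - 1) * (k * d1 (x + s • ee i)) :=
    (line_tendsto x (ee i)).eventually e0
  refine HasDerivAt.congr_of_eventuallyEq ?_ e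
  have hG : HasDerivAt G1 (G2 (k * PP j b ε x - 1)) (k * PP j b ε (x + (0:ℝ) • ee i) - 1) := by
    simpa using hasDeriv_G1 ht
  have hA := HasDerivAt.comp (0:ℝ) hG (hPP x hx0)
  have hB := (hasD2 j (fun t => has_osc b (-(N / 4)) t) (fun t => has_osc1 b (-(N / 4)) t)
    (fun t => (has_osc1 b (1 / 2 - N / 4) t).const_mul ε) i x hx0).const_mul k
  refine (hA.mul hB).congr_deriv ?_
  simp [hd1]
  ring

lemma lap_lower {j : Fin N} {b ε κ : ℝ} (hN : 2 ≤ N) (hb : 0 < b) (hε : 0 < ε)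
    (hκ : κ = (N - 1) * ε / (1 + ε)) (hbκ : 8 * b ^ 2 = κ) (x : EE N) (hx : x ∈ UU j b ε) :
    -((N : ℝ) ^ 2 / 4 - κ / 2) * PP j b ε x ≤
     ‖x‖ ^ 2 * ∑ i, D2 j (osc1 b (-(N / 4))) (fun t => ε * osc1 b (1 / 2 - N / 4) t)
      (osc2 b (-(N / 4))) (fun t => ε * osc2 b (1 / 2 - N / 4) t) i x := by
  have hx0 := UU_ne j b ε hx
  rw [qLap x hx0]
  have ho := UU_osc_pos hb (-(N / 4)) hx
  have hP := PP_eq j b ε x hx0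
  set o := osc b (-(N / 4)) (Real.log (‖x‖ ^ 2))
  have hxj : x j ≤ ‖x‖ := (le_abs_self _).trans (by simpa using PiLp.norm_apply_le x j)
  have hN1 : (0:ℝ) ≤ N - 1 := by
    have : (2:ℝ) ≤ N := by exact_mod_cast hN
    linarith
  have hk0 : 0 ≤ κ := by rw [hκ]; positivity
  have h1 : κ * PP j b ε x ≤ ε * (N - 1) * ‖x‖ * o := by
    have : ε * (N - 1) = κ * (1 + ε) := by rw [hκ]; field_simp
    rw [this, hP]
    have : (x j + ε * ‖x‖) * o ≤ (1 + ε) * ‖x‖ * o := by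
      apply mul_le_mul_of_nonneg_right _ ho.le; linarith
    nlinarith
  have h2 : 4 * b ^ 2 = κ / 2 := by linarith
  rw [h2]
  linarith

lemma pointwise {j : Fin N} {b ε κ k : ℝ} (hN : 2 ≤ N) (hb : 0 < b) (hε : 0 < ε)
    (hκ : κ = (N - 1) * ε / (1 + ε)) (hbκ : 8 * b ^ 2 = κ) (hk : 0 < k)
    (hc : 0 ≤ (N : ℝ) ^ 2 / 4 - κ / 2) (x : EE N) :
    -(uu j b ε k x * ∑ i, fderiv ℝ (fun y => fderiv ℝ (uu j b ε k) y (ee i)) x (ee i)) ≤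
      ((N : ℝ) ^ 2 / 4 - κ / 2 + (κ / 2) / 2) * (uu j b ε k x ^ 2 / ‖x‖ ^ 2) +
      (UU j b ε).indicator (fun _ => 2 * ((N : ℝ) ^ 2 / 4 - κ / 2) ^ 2 / (κ / 2) +
        ((N : ℝ) ^ 2 / 4 - κ / 2)) x := by
  have hκ0 : 0 < κ := by rw [← hbκ]; positivity
  have hCn : 0 ≤ 2 * ((N : ℝ) ^ 2 / 4 - κ / 2) ^ 2 / (κ / 2) +
        ((N : ℝ) ^ 2 / 4 - κ / 2) := by positivity
  by_cases hx : x ∈ UU j b ε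
  · rw [Set.indicator_of_mem hx]
    have hu : uu j b ε k x = GG (k * PP j b ε x - 1) := by simp [uu, hx]
    by_cases ht : 0 < k * PP j b ε x - 1
    · rw [hu]
      simp only [uu_lap hb k x hx ht]
      rw [Finset.sum_add_distrib, ← Finset.mul_sum, ← Finset.mul_sum]
      refine pointwise_alg ht ?_ hc (by positivity) (Finset.sum_nonneg fun i _ => sq_nonneg _) ?_
      · have := hx.1; nlinarith
      · rw [← Finset.mul_sum]
        have := mul_le_mul_of_nonneg_left (lap_lower hN hb hε hκ hbκ x hx) hk.le
        linarith
    · rw [hu, GG_zero (not_lt.1 ht)]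
      simpa using hCn
  · have : uu j b ε k x = 0 := by simp [uu, hx]
    rw [this, Set.indicator_of_notMem hx]; simp

end main

section final
variable {N : ℕ}

lemma construct (hN : 2 ≤ N) (j : Fin N) {ε : ℝ} (hε : 0 < ε) :
    ∃ R : ℝ, 0 < R ∧ ∃ u : EE N → ℝ, ContDiff ℝ (⊤ : ℕ∞) u ∧ HasCompactSupport u ∧
      tsupport u ⊆ {x | 0 < ‖x‖ ∧ 0 < x j + ε * ‖x‖ ∧ ‖x‖ < R} ∧
      0 < (∫ x, u x ^ 2 / ‖x‖ ^ 2) ∧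
      (∫ x, ‖gradient u x‖ ^ 2) < (N : ℝ) ^ 2 / 4 * ∫ x, u x ^ 2 / ‖x‖ ^ 2 := by
  have hN2 : (2:ℝ) ≤ N := by exact_mod_cast hN
  obtain ⟨κ, hκ⟩ : ∃ κ : ℝ, κ = (N - 1) * ε / (1 + ε) := ⟨_, rfl⟩
  have hκ0 : 0 < κ := by
    rw [hκ]
    have : (0:ℝ) < N - 1 := by linarith
    positivity
  have hκ1 : κ ≤ N - 1 := by
    rw [hκ, div_le_iff₀ (by positivity)]
    nlinarith
  obtain ⟨b, hb, hbκ⟩ : ∃ b : ℝ, 0 < b ∧ 8 * b ^ 2 = κ := by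
    refine ⟨Real.sqrt (κ / 8), Real.sqrt_pos.2 (by positivity), ?_⟩
    rw [Real.sq_sqrt (by positivity)]; ring
  have hc : 0 ≤ (N : ℝ) ^ 2 / 4 - κ / 2 := by nlinarith [sq_nonneg ((N : ℝ) - 1)]
  set R := Real.exp (π / (2 * b)) with hR
  have hR0 : 0 < R := Real.exp_pos _
  set C := 2 * ((N : ℝ) ^ 2 / 4 - κ / 2) ^ 2 / (κ / 2) + ((N : ℝ) ^ 2 / 4 - κ / 2) with hC
  have hC0 : 0 ≤ C := by positivity
  -- a point of U
  obtain ⟨x0, hx0⟩ : ∃ x0 : EE N, x0 ∈ UU j b ε := by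
    have hpos : 0 < Real.exp (π / (4 * b)) := Real.exp_pos _
    have hn : ‖Real.exp (π / (4 * b)) • (ee j : EE N)‖ = Real.exp (π / (4 * b)) := by
      simp [norm_smul, ee]
    refine ⟨Real.exp (π / (4 * b)) • ee j, ?_, ?_, ?_⟩
    · rw [hn]; exact Real.one_lt_exp_iff.2 (by positivity)
    · rw [hn]; apply Real.exp_lt_exp.2
      apply div_lt_div_of_pos_left Real.pi_pos (by positivity); linarith
    · rw [hn]
      have : (Real.exp (π / (4 * b)) • (ee j : EE N)) j = Real.exp (π / (4 * b)) := by simp [ee]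
      rw [this]; positivity
  have hP0 : 0 < PP j b ε x0 := by
    rw [PP_eq j b ε x0 (UU_ne j b ε hx0)]
    exact mul_pos hx0.2.2 (UU_osc_pos hb _ hx0)
  set m := PP j b ε x0 / 2 with hm
  have hm0 : 0 < m := by positivity
  have hfinU : volume (UU j b ε) ≠ ⊤ :=
    ((measure_mono (UU_sub j b ε)).trans_lt
      (isCompact_closedBall (0 : EE N) _).measure_lt_top).ne
  -- small set
  obtain ⟨B, hBo, hx0B, hBU, hBm⟩ : ∃ B : Set (EE N), IsOpen B ∧ x0 ∈ B ∧ B ⊆ UU j b ε ∧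
      ∀ y ∈ B, m ≤ PP j b ε y := by
    have h1 : ∀ᶠ y in 𝓝 x0, y ∈ UU j b ε ∧ m ≤ PP j b ε y := by
      filter_upwards [(UU_open j b ε).mem_nhds hx0,
        (PP_smooth j b ε x0 (UU_ne j b ε hx0)).continuousAt.eventually_const_lt
          (show m < PP j b ε x0 by rw [hm]; linarith)] with y h1 h2
      exact ⟨h1, h2.le⟩
    obtain ⟨B, h2, h3, h4⟩ := eventually_nhds_iff.1 h1
    exact ⟨B, h3, h4, fun y hy => (h2 y hy).1, fun y hy => (h2 y hy).2⟩
  have hfinB : volume B ≠ ⊤ := ((measure_mono hBU).trans_lt hfinU.lt_top).ne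
  have hvB : 0 < (volume B).toReal :=
    ENNReal.toReal_pos (hBo.measure_pos volume ⟨x0, hx0B⟩).ne' hfinB
  set vB := (volume B).toReal
  set vU := (volume (UU j b ε)).toReal
  have hvU : 0 ≤ vU := ENNReal.toReal_nonneg
  -- choice of k
  set g := (κ / 4) * (Real.exp (-1) ^ 2 / R ^ 2 * vB) with hg
  have hg0 : 0 < g := by positivity
  set M := C * vU / g + 1 with hM
  have hM1 : 1 ≤ M := by
    have : 0 ≤ C * vU / g := by positivity
    linarith
  have hMg : C * vU < g * M ^ 2 := by
    have h1 : C * vU < g * M := by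
      rw [hM, mul_add, mul_div_cancel₀ _ hg0.ne']; linarith
    have h2 : M ≤ M ^ 2 := by nlinarith
    nlinarith
  set k := (M + 1) / m with hk
  have hk0 : 0 < k := by positivity
  have hkm : k * m = M + 1 := by rw [hk]; field_simp
  have hsm := uu_smooth (j := j) (ε := ε) hb k
  have hcs := uu_compact (j := j) (ε := ε) hb k
  have hts := uu_tsupport (j := j) (ε := ε) hb k
  obtain ⟨-, hI2, hgreen⟩ := green _ hsm hcs
  set u := uu j b ε k with hu
  -- integrability of the Hardy term
  have hHeq : (fun x => u x ^ 2 / ‖x‖ ^ 2) = fun x => u x ^ 2 * (max (‖x‖ ^ 2) 1)⁻¹ := by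
    funext x
    by_cases hx : x ∈ UU j b ε
    · rw [max_eq_left, div_eq_mul_inv]
      have := hx.1; nlinarith
    · have : u x = 0 := by simp [hu, uu, hx]
      simp [this]
  have hHI : Integrable (fun x => u x ^ 2 / ‖x‖ ^ 2) := by
    rw [hHeq]
    refine Continuous.integrable_of_hasCompactSupport ?_ ?_
    · refine (hsm.continuous.pow 2).mul (Continuous.inv₀ (by fun_prop) ?_)
      intro x
      exact (lt_of_lt_of_le one_pos (le_max_right _ _)).ne'
    · have : HasCompactSupport (fun x => u x ^ 2) := by
        simp only [sq]
        exact hcs.mul_right (f' := u)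
      exact this.mul_right
  -- lower bound
  have hlow : Real.exp (-1) ^ 2 / R ^ 2 * vB * M ^ 2 ≤ ∫ x, u x ^ 2 / ‖x‖ ^ 2 := by
    have h1 : ∫ x, B.indicator (fun _ => (M * Real.exp (-1)) ^ 2 / R ^ 2) x ≤
        ∫ x, u x ^ 2 / ‖x‖ ^ 2 := by
      refine integral_mono ((integrable_indicator_iff hBo.measurableSet).2
        (integrableOn_const hfinB)) hHI ?_
      intro x
      by_cases hx : x ∈ B
      · rw [Set.indicator_of_mem hx]
        have hxU := hBU hx
        have hux : u x = GG (k * PP j b ε x - 1) := by simp [hu, uu, hxU]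
        have hMle : M ≤ k * PP j b ε x - 1 := by
          have := mul_le_mul_of_nonneg_left (hBm x hx) hk0.le
          linarith
        have hge : M * Real.exp (-1) ≤ u x := by
          rw [hux]
          refine le_trans ?_ (GG_lower (hM1.trans hMle))
          exact mul_le_mul_of_nonneg_right hMle (Real.exp_pos _).le
        have hxn : 0 < ‖x‖ := by linarith [hxU.1]
        have hxR : ‖x‖ ≤ R := hxU.2.1.le
        have hM0 : 0 ≤ M * Real.exp (-1) := by positivity
        show (M * Real.exp (-1)) ^ 2 / R ^ 2 ≤ u x ^ 2 / ‖x‖ ^ 2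
        gcongr
      · rw [Set.indicator_of_notMem hx]; positivity
    rw [integral_indicator hBo.measurableSet, setIntegral_const] at h1
    refine le_trans (le_of_eq ?_) h1
    simp only [smul_eq_mul, Measure.real]
    ring
  -- upper bound
  have hup : ∫ x, ‖gradient u x‖ ^ 2 ≤
      ((N : ℝ) ^ 2 / 4 - κ / 2 + (κ / 2) / 2) * (∫ x, u x ^ 2 / ‖x‖ ^ 2) + C * vU := by
    have hIU : Integrable ((UU j b ε).indicator (fun _ => C)) :=
      (integrable_indicator_iff (UU_open j b ε).measurableSet).2 (integrableOn_const hfinU)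
    rw [hgreen]
    have h1 := integral_mono hI2.neg ((hHI.const_mul
      ((N : ℝ) ^ 2 / 4 - κ / 2 + (κ / 2) / 2)).add hIU)
      (fun x => pointwise hN hb hε hκ hbκ hk0 hc x)
    refine h1.trans (le_of_eq ?_)
    rw [integral_add' (hHI.const_mul _) hIU, integral_const_mul,
      integral_indicator (UU_open j b ε).measurableSet, setIntegral_const]
    simp only [smul_eq_mul, Measure.real]
    ring
  refine ⟨R, hR0, u, hsm, hcs, ?_, ?_, ?_⟩
  · intro x hx
    have h := hts hx
    exact ⟨by linarith [h.1], h.2.2, h.2.1⟩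
  · refine lt_of_lt_of_le ?_ hlow
    positivity
  · refine lt_of_le_of_lt hup ?_
    have : g * M ^ 2 ≤ κ / 4 * ∫ x, u x ^ 2 / ‖x‖ ^ 2 := by
      have := mul_le_mul_of_nonneg_left hlow (show 0 ≤ κ / 4 by positivity)
      rw [hg]; linarith
    linarith

lemma lastCoord_eq (hN : 2 ≤ N) (x : EE N) : lastCoord x = x ⟨N - 1, by omega⟩ := by
  unfold lastCoord
  rw [Finset.sum_eq_single (⟨N - 1, by omega⟩ : Fin N)]
  · rw [if_pos]; simp; omega
  · intro i _ hi
    rw [if_neg]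
    intro h
    apply hi
    ext; simp; omega
  · simp

lemma lastCoord_cont (hN : 2 ≤ N) : Continuous (fun x : EE N => lastCoord x) := by
  simp only [lastCoord_eq hN]
  fun_prop

lemma cone_open (hN : 2 ≤ N) (γ : ℝ) : IsOpen (cone N γ) :=
  (isOpen_lt continuous_const continuous_norm).inter
    (isOpen_lt (continuous_norm.mul continuous_const) (lastCoord_cont hN))

end final

end HardyAux

open HardyAux in
theorem stmt8 (N : ℕ) (hN : 2 ≤ N) :
    ∀ δ : ℝ, δ ∈ Set.Ioo 0 (π / 2) →
      ∃ Ω : Set (EuclideanSpace ℝ (Fin N)),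
        IsOpen Ω ∧ Bornology.IsBounded Ω ∧ Ω ⊆ cone N (π / 2 + δ) ∧
        (0 : EuclideanSpace ℝ (Fin N)) ∈ frontier Ω ∧
        (∃ u : EuclideanSpace ℝ (Fin N) → ℝ,
          ContDiff ℝ (⊤ : ℕ∞) u ∧ HasCompactSupport u ∧ tsupport u ⊆ Ω ∧
          0 < (∫ x in Ω, (u x) ^ 2 / ‖x‖ ^ 2) ∧
          (∫ x in Ω, ‖gradient u x‖ ^ 2) <
            ((N : ℝ) ^ 2 / 4) * ∫ x in Ω, (u x) ^ 2 / ‖x‖ ^ 2) ∧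
        hardyConst Ω < (N : ℝ) ^ 2 / 4 := by
  intro δ hδ
  have hε : 0 < Real.sin δ := Real.sin_pos_of_pos_of_lt_pi hδ.1 (by linarith [hδ.2, Real.pi_pos])
  have hcos : Real.cos (π / 2 + δ) = -Real.sin δ := by
    rw [add_comm]; exact Real.cos_add_pi_div_two δ
  obtain ⟨R, hR, u, hsm, hcs, hts, hpos, hlt⟩ :=
    construct hN (⟨N - 1, by omega⟩ : Fin N) hε
  set Ω : Set (EuclideanSpace ℝ (Fin N)) := cone N (π / 2 + δ) ∩ Metric.ball 0 R with hΩ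
  have hΩo : IsOpen Ω := (cone_open hN _).inter Metric.isOpen_ball
  have htsΩ : tsupport u ⊆ Ω := by
    intro x hx
    obtain ⟨h1, h2, h3⟩ := hts hx
    refine ⟨⟨h1, ?_⟩, by simpa using h3⟩
    rw [hcos, lastCoord_eq hN]; linarith
  have hout : ∀ x, x ∉ Ω → x ∉ tsupport u := fun x hx h => hx (htsΩ h)
  have e1 : ∫ x in Ω, (u x) ^ 2 / ‖x‖ ^ 2 = ∫ x, (u x) ^ 2 / ‖x‖ ^ 2 := by
    refine setIntegral_eq_integral_of_forall_compl_eq_zero fun x hx => ?_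
    rw [image_eq_zero_of_notMem_tsupport (hout x hx)]; simp
  have e2 : ∫ x in Ω, ‖gradient u x‖ ^ 2 = ∫ x, ‖gradient u x‖ ^ 2 := by
    refine setIntegral_eq_integral_of_forall_compl_eq_zero fun x hx => ?_
    have : fderiv ℝ u x = 0 := by
      by_contra h
      exact hout x hx (support_fderiv_subset ℝ h)
    simp [gradient, this]
  rw [← e1] at hpos
  rw [← e1, ← e2] at hlt
  refine ⟨Ω, hΩo, Metric.isBounded_ball.subset Set.inter_subset_right, Set.inter_subset_left, ?_,
    ⟨u, hsm, hcs, htsΩ, hpos, hlt⟩, ?_⟩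
  · rw [hΩo.frontier_eq]
    refine ⟨?_, fun h => ?_⟩
    · rw [Metric.mem_closure_iff]
      intro η hη
      have hs : 0 < min η R / 2 := by positivity
      set s := min η R / 2 with hsdef
      have hn : ‖s • (ee ⟨N - 1, by omega⟩ : EE N)‖ = s := by
        simp [norm_smul, ee, abs_of_pos hs]
      have hsη : s < η := by have := min_le_left η R; linarith
      have hsR : s < R := by have := min_le_right η R; linarith
      refine ⟨s • ee ⟨N - 1, by omega⟩, ⟨⟨?_, ?_⟩, ?_⟩, ?_⟩
      · rw [hn]; exact hs
      · rw [hn, hcos, lastCoord_eq hN]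
        simp [ee]
        nlinarith
      · simpa [hn] using hsR
      · rw [dist_zero_left, hn]; exact hsη
    · have := h.1.1
      simp at this
  · refine lt_of_le_of_lt (csInf_le ?_ ⟨u, hsm, hcs, htsΩ, hpos, rfl⟩) ?_
    · refine ⟨0, ?_⟩
      rintro ρ ⟨v, -, -, -, hv, rfl⟩
      exact div_nonneg (integral_nonneg fun x => by positivity) hv.le
    · rw [div_lt_iff₀ hpos]; exact hlt
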